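/- arXiv:2010.09310 — 3 statements merged into one kernel-verified Lean document; each statement's English description precedes it below -/
import Mathlib

section
/- Let {F_n}_{n≥1} be a family of distribution functions on [0,1] with F_n(0) = 0 satisfying condition (i). Then: (a) the functions t ↦ F_n(t)/t are bounded for t ∈ (0,1] uniformly in n, i.e. sup_{n, 0<t≤1} F_n(t)/t < ∞; (b) if in addition condition (ii) holds, then the functions t ↦ A_n(t)/t, where A_n(t) = ∫₀¹ (cos(t/u) − 1) dF_n(u), are bounded for 0 < |t| < 1 uniformly in n, i.e. there exists C < ∞ such that |A_n(t)| ≤ C|t| for all n and all |t| < 1. -/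
open MeasureTheory ProbabilityTheory Filter Set

/-- Dyadic majorant of `|cos x - 1|`, written in the scale-invariant variable `x = t / u`. -/
lemma abs_cos_div_sub_one_le_dyadic {t : ℝ} (ht : t ≠ 0) (u : ℝ) :
    ∃ k : ℕ, |Real.cos (t / u) - 1| ≤ 2 * (1 / 4) ^ k ∧ u ≤ 2 ^ k * |t| := by
  have hs : 0 < |t| := abs_pos.mpr ht
  rcases le_or_gt u |t| with hu | hu
  · refine ⟨0, ?_, by simpa using hu⟩
    rw [abs_le]
    constructor <;> linarith [Real.neg_one_le_cos (t / u), Real.cos_le_one (t / u)]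
  · have hu0 : 0 < u := hs.trans hu
    obtain ⟨k, hk, hk'⟩ := exists_nat_pow_near (x := u / |t|) (y := (2 : ℝ))
      ((one_le_div hs).mpr hu.le) one_lt_two
    refine ⟨k + 1, ?_, ((div_lt_iff₀ hs).mp hk').le⟩
    have hxk : (t / u) ^ 2 ≤ (1 / 4) ^ k := by
      have h1 : |t| / u ≤ (1 / 2) ^ k := by
        rw [one_div_pow, ← one_div_div]
        exact one_div_le_one_div_of_le (by positivity) hk
      calc (t / u) ^ 2 = (|t| / u) ^ 2 := by rw [div_pow, div_pow, sq_abs]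
        _ ≤ ((1 / 2) ^ k) ^ 2 := by gcongr
        _ = (1 / 4) ^ k := by rw [← pow_mul, mul_comm, pow_mul]; norm_num
    rw [abs_of_nonpos (by linarith [Real.cos_le_one (t / u)]), pow_succ]
    linarith [Real.one_sub_sq_div_two_le_cos (x := t / u)]

/-- A linear bound on the distribution function of `μ` gives a linear bound on
`t ↦ ∫ (cos (t / u) - 1) ∂μ`. -/
lemma abs_integral_cos_div_sub_one_le {μ : Measure ℝ} {M : ℝ} (hM : 0 ≤ M)
    (hμ : ∀ t : ℝ, 0 < t → μ (Iic t) ≤ ENNReal.ofReal (M * t)) (t : ℝ) :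
    |∫ u, (Real.cos (t / u) - 1) ∂μ| ≤ 4 * M * |t| := by
  rcases eq_or_ne t 0 with rfl | ht
  · simp
  have hs : 0 < |t| := abs_pos.mpr ht
  have hsum : HasSum (fun k : ℕ => 2 * M * |t| * (1 / 2 : ℝ) ^ k) (4 * M * |t|) := by
    rw [show 4 * M * |t| = 2 * M * |t| * 2 by ring]
    exact hasSum_geometric_two.mul_left _
  rw [← Real.norm_eq_abs]
  refine (norm_integral_le_lintegral_norm _).trans
    (ENNReal.toReal_le_of_le_ofReal (by positivity : 0 ≤ 4 * M * |t|) ?_)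
  calc ∫⁻ u, ENNReal.ofReal ‖Real.cos (t / u) - 1‖ ∂μ
      ≤ ∫⁻ u, ∑' k : ℕ, (Iic (2 ^ k * |t|)).indicator
          (fun _ => ENNReal.ofReal (2 * (1 / 4) ^ k)) u ∂μ := by
        refine lintegral_mono fun u => ?_
        obtain ⟨k, hk, hku⟩ := abs_cos_div_sub_one_le_dyadic ht u
        refine le_trans ?_ (ENNReal.le_tsum k)
        rw [indicator_of_mem (mem_Iic.mpr hku)]
        exact ENNReal.ofReal_le_ofReal hk
    _ = ∑' k : ℕ, ENNReal.ofReal (2 * (1 / 4) ^ k) * μ (Iic (2 ^ k * |t|)) := by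
        rw [lintegral_tsum fun k => (measurable_const.indicator measurableSet_Iic).aemeasurable]
        exact tsum_congr fun k => lintegral_indicator_const measurableSet_Iic _
    _ ≤ ∑' k : ℕ, ENNReal.ofReal (2 * M * |t| * (1 / 2) ^ k) := by
        refine ENNReal.tsum_le_tsum fun k => ?_
        calc _ ≤ ENNReal.ofReal (2 * (1 / 4) ^ k) * ENNReal.ofReal (M * (2 ^ k * |t|)) := by
              gcongr
              exact hμ _ (by positivity)
          _ = _ := by
              rw [← ENNReal.ofReal_mul (by positivity)]
              congr 1
              have : (1 / 4 : ℝ) ^ k * 2 ^ k = (1 / 2) ^ k := by rw [← mul_pow]; norm_num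
              rw [← this]
              ring
    _ = ENNReal.ofReal (4 * M * |t|) := by
        rw [← ENNReal.ofReal_tsum_of_nonneg (fun k => by positivity) hsum.summable, hsum.tsum_eq]

/-- Lemma on uniform boundedness of `F_n(t)/t` and of `A_n(t)/t` for a family of
distribution functions on `[0,1]` with `F_n(0) = 0` satisfying conditions (i) and (ii). -/
theorem uniform_bounds_for_distribution_family
    (μ : ℕ → Measure ℝ) [∀ n, IsProbabilityMeasure (μ n)]
    (hsupp : ∀ n, μ n (Set.Ioc (0 : ℝ) 1) = 1)
    (F : ℕ → ℝ → ℝ)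
    (hF : ∀ n t, F n t = (μ n (Set.Iic t)).toReal)
    (α : ℕ → ℝ)
    (hαpos : ∀ n, 0 < α n)
    (hαbdd : ∃ c C : ℝ, 0 < c ∧ ∀ n, c ≤ α n ∧ α n ≤ C)
    -- condition (i): `lim_{t→0⁺} sup_n |F_n(t)/t − α_n| = 0`
    (hcondi : ∀ ε > (0 : ℝ), ∃ δ > (0 : ℝ), ∀ t : ℝ, 0 < t → t < δ →
      ∀ n, |F n t / t - α n| < ε)
    -- condition (ii): `lim_{t→0⁺} sup_n ∫₀ᵗ (1/u)|F_n(u)/u − α_n| du = 0`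
    (hcondii : ∀ ε > (0 : ℝ), ∃ δ > (0 : ℝ), ∀ t : ℝ, 0 < t → t < δ →
      ∀ n, (∫⁻ u in Set.Ioo (0 : ℝ) t,
        ENNReal.ofReal (|F n u / u - α n| / u)) < ENNReal.ofReal ε) :
    -- (a): `F_n(t)/t` bounded on `(0,1]` uniformly in `n`
    (∃ M : ℝ, ∀ n, ∀ t : ℝ, 0 < t → t ≤ 1 → F n t / t ≤ M) ∧
    -- (b): `|A_n(t)| ≤ C|t|` for `|t| < 1`, uniformly in `n`, where
    -- `A_n(t) = ∫₀¹ (cos(t/u) − 1) dF_n(u)`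
    (∃ C : ℝ, ∀ n, ∀ t : ℝ, |t| < 1 →
      |∫ u, (Real.cos (t / u) - 1) ∂(μ n)| ≤ C * |t|) := by
  obtain ⟨c, C, hc, hα⟩ := hαbdd
  obtain ⟨δ, hδ, hnear⟩ := hcondi 1 one_pos
  have hC : 0 < C := hc.trans_le ((hα 0).1.trans (hα 0).2)
  have hM : 0 ≤ C + 1 + 1 / δ := by positivity
  have hbound : ∀ n, ∀ t : ℝ, 0 < t → F n t / t ≤ C + 1 + 1 / δ := by
    intro n t ht
    rcases lt_or_ge t δ with h | h
    · have := (abs_lt.mp (hnear t ht h n)).2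
      have : 0 < 1 / δ := by positivity
      linarith [(hα n).2]
    · have hF1 : F n t ≤ 1 := by
        rw [hF]
        exact measureReal_le_one
      have : F n t / t ≤ 1 / δ := by gcongr
      linarith
  refine ⟨⟨_, fun n t ht _ => hbound n t ht⟩, 4 * (C + 1 + 1 / δ), fun n t _ =>
    abs_integral_cos_div_sub_one_le hM (fun s hs => ?_) t⟩
  rw [← ENNReal.ofReal_toReal (measure_ne_top (μ n) (Iic s)), ← hF]
  exact ENNReal.ofReal_le_ofReal ((div_le_iff₀ hs).mp (hbound n s hs))
end

section
/- Let {F_n}_{n≥1} be a family of distribution functions on [0,1] with F_n(0) = 0 satisfying conditions (i) and (ii). Then for every n, lim_{t→0} ( (1/t)∫₀¹ sin(t/u) dF_n(u) + α_n log|t| ) = c_{F_n}, where c_{F_n} = 1 − α_n γ + b_{F_n}, b_{F_n} = ∫₀¹ (1/u)(F_n(u)/u − α_n) du, and γ is the Euler–Mascheroni constant. Moreover the convergence is uniform in n: lim_{t→0} sup_n | (1/t)∫₀¹ sin(t/u) dF_n(u) + α_n log|t| − c_{F_n} | = 0. -/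
open MeasureTheory ProbabilityTheory Filter Set

theorem integral_exp_neg_mul_log :
    ∫ x in Ioi (0 : ℝ), Real.exp (-x) * Real.log x = -Real.eulerMascheroniConstant := by
  have hΓ : HasDerivAt Complex.GammaIntegral (-(Real.eulerMascheroniConstant : ℂ)) 1 := by
    refine Complex.hasDerivAt_Gamma_one.congr_of_eventuallyEq ?_
    have h : {s : ℂ | 0 < s.re} ∈ nhds (1 : ℂ) :=
      (isOpen_lt continuous_const Complex.continuous_re).mem_nhds (by simp)
    filter_upwards [h] with s hs using (Complex.Gamma_eq_integral hs).symm
  have h := (Complex.hasDerivAt_GammaIntegral (s := 1) (by simp)).unique hΓ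
  rw [← Complex.ofReal_inj, Complex.ofReal_neg, ← h, ← integral_complex_ofReal]
  congr 1 with x
  simp [mul_comm]

theorem integrableOn_exp_neg_mul_log :
    IntegrableOn (fun x : ℝ => Real.exp (-x) * Real.log x) (Ioi 0) := by
  refine Integrable.of_integral_ne_zero ?_
  rw [integral_exp_neg_mul_log]
  linarith [Real.one_half_lt_eulerMascheroniConstant]

theorem abs_sin_sub_one_add_exp_neg_div_sq_le {v : ℝ} (hv : 0 < v) :
    |(Real.sin v - 1 + Real.exp (-v)) / v ^ 2| ≤ 4 * (1 + v ^ 2)⁻¹ := by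
  rw [abs_div, abs_of_pos (pow_pos hv 2), ← div_eq_mul_inv,
    div_le_div_iff₀ (by positivity) (by positivity)]
  rcases le_total v 1 with h | h
  · have h1 := Real.abs_exp_sub_one_sub_id_le (x := -v) (by rw [abs_neg, abs_of_pos hv]; exact h)
    have h2 := Real.sin_gt_sub_cube hv
    have h3 := Real.sin_lt hv
    rw [abs_le] at h1
    have h4 : |Real.sin v - 1 + Real.exp (-v)| ≤ 2 * v ^ 2 := by
      rw [abs_le]
      constructor <;> nlinarith [mul_nonneg (sq_nonneg v) (sub_nonneg.2 h)]
    nlinarith [sq_nonneg v, mul_nonneg (sq_nonneg v) (sub_nonneg.2 (pow_le_one₀ hv.le h : v ^ 2 ≤ 1))]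
  · have h1 : Real.exp (-v) ≤ 1 := Real.exp_le_one_iff.2 (by linarith)
    have h4 : |Real.sin v - 1 + Real.exp (-v)| ≤ 2 := by
      rw [abs_le]
      constructor <;> linarith [Real.exp_pos (-v), Real.sin_le_one v, Real.neg_one_le_sin v]
    nlinarith [one_le_pow₀ (n := 2) h]

theorem integrableOn_sin_sub_one_add_exp_neg_div_sq :
    IntegrableOn (fun v : ℝ => (Real.sin v - 1 + Real.exp (-v)) / v ^ 2) (Ioi 0) := by
  refine ((integrable_inv_one_add_sq.const_mul 4).integrableOn (s := Ioi (0 : ℝ))).mono' ?_ ?_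
  · exact Measurable.aestronglyMeasurable (by fun_prop)
  · exact (ae_restrict_mem measurableSet_Ioi).mono fun v hv =>
      abs_sin_sub_one_add_exp_neg_div_sq_le hv

theorem integral_mul_exp_neg_mul {v : ℝ} (hv : 0 < v) :
    ∫ x in Ioi (0 : ℝ), x * Real.exp (-(v * x)) = 1 / v ^ 2 := by
  have h := Real.integral_rpow_mul_exp_neg_mul_Ioi (a := 2) two_pos hv
  norm_num at h
  rw [h]
  simp

theorem integrableOn_mul_exp_neg_mul {v : ℝ} (hv : 0 < v) :
    IntegrableOn (fun x : ℝ => x * Real.exp (-(v * x))) (Ioi 0) := by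
  refine Integrable.of_integral_ne_zero ?_
  rw [integral_mul_exp_neg_mul hv]
  positivity

theorem tendsto_exp_neg_mul_atTop {x : ℝ} (hx : 0 < x) :
    Tendsto (fun v : ℝ => Real.exp (-(x * v))) atTop (nhds 0) :=
  Real.tendsto_exp_neg_atTop_nhds_zero.comp (tendsto_id.const_mul_atTop hx)

theorem integral_sin_sub_one_add_exp_neg_mul_exp {x : ℝ} (hx : 0 < x) :
    ∫ v in Ioi (0 : ℝ), (Real.sin v - 1 + Real.exp (-v)) * Real.exp (-(x * v)) =
      1 / (1 + x ^ 2) - 1 / x + 1 / (1 + x) := by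
  have hd : ∀ v ∈ Ici (0 : ℝ), HasDerivAt
      (fun v => -((Real.cos v + x * Real.sin v) / (1 + x ^ 2) * Real.exp (-(x * v)))
        + Real.exp (-(x * v)) / x - Real.exp (-v) * Real.exp (-(x * v)) / (1 + x))
      ((Real.sin v - 1 + Real.exp (-v)) * Real.exp (-(x * v))) v := by
    intro v _
    have he : HasDerivAt (fun v => Real.exp (-(x * v))) (Real.exp (-(x * v)) * -(x * 1)) v :=
      ((hasDerivAt_id v).const_mul x).neg.exp
    have he1 : HasDerivAt (fun v => Real.exp (-v)) (Real.exp (-v) * -1) v :=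
      (hasDerivAt_id v).neg.exp
    have hs := ((Real.hasDerivAt_cos v).add ((Real.hasDerivAt_sin v).const_mul x)).div_const
      (1 + x ^ 2)
    convert! ((hs.mul he).neg.add (he.div_const x)).sub ((he1.mul he).div_const (1 + x)) using 1
    have : 1 + x ^ 2 ≠ 0 := by positivity
    have : 1 + x ≠ 0 := by positivity
    simp only [Pi.add_apply]
    field_simp
    ring
  have hbd : ∀ {g : ℝ → ℝ} {C : ℝ}, (∀ v ∈ Ioi (0 : ℝ), |g v| ≤ C) →
      Tendsto (fun v => g v * Real.exp (-(x * v))) atTop (nhds 0) := by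
    intro g C hg
    refine bdd_le_mul_tendsto_zero' C ?_ (tendsto_exp_neg_mul_atTop hx)
    filter_upwards [eventually_gt_atTop 0] with v hv using hg v hv
  have hlim : Tendsto
      (fun v => -((Real.cos v + x * Real.sin v) / (1 + x ^ 2) * Real.exp (-(x * v)))
        + Real.exp (-(x * v)) / x - Real.exp (-v) * Real.exp (-(x * v)) / (1 + x))
      atTop (nhds (-0 + 0 / x - 0 / (1 + x))) := by
    refine ((Tendsto.neg ?_).add ((tendsto_exp_neg_mul_atTop hx).div_const x)).sub
      (Tendsto.div_const ?_ _)
    · refine hbd (C := (1 + x) / (1 + x ^ 2)) fun v _ => ?_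
      rw [abs_div, abs_of_pos (by positivity : 0 < 1 + x ^ 2)]
      gcongr
      refine (abs_add_le _ _).trans (add_le_add (Real.abs_cos_le_one v) ?_)
      rw [abs_mul, abs_of_pos hx]
      exact mul_le_of_le_one_right hx.le (Real.abs_sin_le_one v)
    · refine hbd (C := 1) fun v hv => ?_
      rw [Real.abs_exp]
      exact Real.exp_le_one_iff.2 (neg_nonpos.2 (le_of_lt hv))
  have hint : IntegrableOn
      (fun v => (Real.sin v - 1 + Real.exp (-v)) * Real.exp (-(x * v))) (Ioi 0) := by
    refine Integrable.mono' ((exp_neg_integrableOn_Ioi 0 hx).const_mul 2)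
      (Continuous.aestronglyMeasurable (by fun_prop)) ?_
    refine (ae_restrict_mem measurableSet_Ioi).mono fun v (hv : 0 < v) => ?_
    have h1 : Real.exp (-v) ≤ 1 := Real.exp_le_one_iff.2 (by linarith)
    rw [Real.norm_eq_abs, abs_mul, Real.abs_exp, neg_mul]
    gcongr
    rw [abs_le]
    constructor <;> linarith [Real.exp_pos (-v), Real.sin_le_one v, Real.neg_one_le_sin v]
  rw [integral_Ioi_of_hasDerivAt_of_tendsto' hd hint hlim]
  simp
  ring

theorem integral_div_one_add_sq_sub_inv :
    ∫ x in Ioi (0 : ℝ), (x / (1 + x ^ 2) - 1 / (1 + x)) = 0 := by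
  have hd : ∀ x ∈ Ici (0 : ℝ), HasDerivAt
      (fun x => Real.log ((1 + x ^ 2) / (1 + x) ^ 2) / 2) (x / (1 + x ^ 2) - 1 / (1 + x)) x := by
    intro x hx
    have hx1 : (0 : ℝ) < 1 + x := by linarith [mem_Ici.1 hx]
    have h1 : HasDerivAt (fun x : ℝ => 1 + x ^ 2) (2 * x) x := by
      simpa using ((hasDerivAt_id x).pow 2).const_add 1
    have h2 : HasDerivAt (fun x : ℝ => (1 + x) ^ 2) (2 * (1 + x)) x := by
      simpa using! ((hasDerivAt_id x).const_add 1).pow 2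
    have h3 : (1 + x ^ 2) / (1 + x) ^ 2 ≠ 0 := by positivity
    convert! ((h1.div h2 (by positivity)).log h3).div_const 2 using 1
    have : 1 + x ^ 2 ≠ 0 := by positivity
    simp only [Pi.div_apply]
    field_simp
  have hint : IntegrableOn (fun x : ℝ => x / (1 + x ^ 2) - 1 / (1 + x)) (Ioi 0) := by
    refine (integrable_inv_one_add_sq.integrableOn (s := Ioi (0 : ℝ))).mono'
      (Measurable.aestronglyMeasurable (by fun_prop)) ?_
    refine (ae_restrict_mem measurableSet_Ioi).mono fun x (hx : 0 < x) => ?_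
    have h : x / (1 + x ^ 2) - 1 / (1 + x) = (x - 1) / (1 + x) * (1 + x ^ 2)⁻¹ := by
      field_simp
      ring
    rw [Real.norm_eq_abs, h, abs_mul, abs_of_pos (by positivity : 0 < (1 + x ^ 2)⁻¹)]
    refine mul_le_of_le_one_left (by positivity) ?_
    rw [abs_div, abs_of_pos (by positivity : 0 < 1 + x), div_le_one (by positivity), abs_le]
    constructor <;> linarith
  have hlim : Tendsto (fun x : ℝ => Real.log ((1 + x ^ 2) / (1 + x) ^ 2) / 2) atTop
      (nhds (Real.log 1 / 2)) := by
    refine Tendsto.div_const (Tendsto.log ?_ one_ne_zero) 2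
    have h0 : Tendsto (fun x : ℝ => (1 + x)⁻¹) atTop (nhds 0) :=
      tendsto_inv_atTop_zero.comp (tendsto_atTop_add_const_left _ 1 tendsto_id)
    have h1 : Tendsto (fun x : ℝ => 1 - 2 * (1 + x)⁻¹ + 2 * (1 + x)⁻¹ ^ 2) atTop
        (nhds (1 - 2 * 0 + 2 * 0 ^ 2)) :=
      (tendsto_const_nhds.sub (h0.const_mul 2)).add ((h0.pow 2).const_mul 2)
    norm_num at h1
    refine h1.congr' ?_
    filter_upwards [eventually_gt_atTop 0] with x hx
    field_simp
    ring
  rw [integral_Ioi_of_hasDerivAt_of_tendsto' hd hint hlim]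
  simp

theorem integral_sin_sub_one_add_exp_neg_div_sq :
    ∫ v in Ioi (0 : ℝ), (Real.sin v - 1 + Real.exp (-v)) / v ^ 2 = 0 := by
  have hF : Integrable (Function.uncurry fun v x : ℝ =>
      (Real.sin v - 1 + Real.exp (-v)) * (x * Real.exp (-(v * x))))
      ((volume.restrict (Ioi 0)).prod (volume.restrict (Ioi 0))) := by
    refine (integrable_prod_iff (Continuous.aestronglyMeasurable (by fun_prop))).2 ⟨?_, ?_⟩
    · exact (ae_restrict_mem measurableSet_Ioi).mono fun v hv =>
        (integrableOn_mul_exp_neg_mul hv).const_mul (Real.sin v - 1 + Real.exp (-v))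
    · refine integrableOn_sin_sub_one_add_exp_neg_div_sq.norm.congr ?_
      refine (ae_restrict_mem measurableSet_Ioi).mono fun v hv => ?_
      have h : ∀ x ∈ Ioi (0 : ℝ), ‖(Real.sin v - 1 + Real.exp (-v)) * (x * Real.exp (-(v * x)))‖
          = |Real.sin v - 1 + Real.exp (-v)| * (x * Real.exp (-(v * x))) := fun x hx => by
        rw [norm_mul, Real.norm_eq_abs, Real.norm_of_nonneg
          (mul_nonneg (le_of_lt hx) (Real.exp_pos _).le)]
      simp only [Function.uncurry_apply_pair]
      rw [setIntegral_congr_fun measurableSet_Ioi h, integral_const_mul,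
        integral_mul_exp_neg_mul hv, norm_div, Real.norm_eq_abs, norm_pow, Real.norm_eq_abs,
        sq_abs, mul_one_div]
  calc ∫ v in Ioi (0 : ℝ), (Real.sin v - 1 + Real.exp (-v)) / v ^ 2
      = ∫ v in Ioi (0 : ℝ), ∫ x in Ioi (0 : ℝ),
          (Real.sin v - 1 + Real.exp (-v)) * (x * Real.exp (-(v * x))) := by
        refine setIntegral_congr_fun measurableSet_Ioi fun v hv => ?_
        rw [integral_const_mul, integral_mul_exp_neg_mul hv, mul_one_div]
    _ = ∫ x in Ioi (0 : ℝ), ∫ v in Ioi (0 : ℝ),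
          (Real.sin v - 1 + Real.exp (-v)) * (x * Real.exp (-(v * x))) :=
        integral_integral_swap hF
    _ = ∫ x in Ioi (0 : ℝ), (x / (1 + x ^ 2) - 1 / (1 + x)) := by
        refine setIntegral_congr_fun measurableSet_Ioi fun x (hx : 0 < x) => ?_
        have h : ∀ v, (Real.sin v - 1 + Real.exp (-v)) * (x * Real.exp (-(v * x)))
            = x * ((Real.sin v - 1 + Real.exp (-v)) * Real.exp (-(x * v))) := fun v => by
          rw [mul_comm v x]
          ring
        simp only [h]
        rw [integral_const_mul, integral_sin_sub_one_add_exp_neg_mul_exp hx]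
        field_simp
        ring
    _ = 0 := integral_div_one_add_sq_sub_inv

theorem tendsto_setIntegral_Ioi_nhdsGT_zero {f : ℝ → ℝ} (hf : IntegrableOn f (Ioi 0)) :
    Tendsto (fun t => ∫ v in Ioi t, f v) (nhdsWithin 0 (Ioi 0))
      (nhds (∫ v in Ioi (0 : ℝ), f v)) := by
  have h := (aecover_Ioi_of_Ioi (μ := volume) (a := fun t : ℝ => t) (A := (0 : ℝ))
    (l := nhdsWithin 0 (Ioi 0)) nhdsWithin_le_nhds).integral_tendsto_of_countably_generated hf
  refine h.congr' ?_
  filter_upwards [self_mem_nhdsWithin] with t ht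
  rw [Measure.restrict_restrict measurableSet_Ioi, Ioi_inter_Ioi, max_eq_left (le_of_lt ht)]

theorem integral_one_sub_exp_neg_div_sq_sub {t : ℝ} (ht : 0 < t)
    (hint : IntegrableOn
      (fun v : ℝ => (1 - Real.exp (-v)) / v ^ 2 - Real.exp (-v) * Real.log v) (Ioi t)) :
    ∫ v in Ioi t, ((1 - Real.exp (-v)) / v ^ 2 - Real.exp (-v) * Real.log v) =
      (1 - Real.exp (-t)) / t - Real.exp (-t) * Real.log t := by
  have hd : ∀ v ∈ Ici t, HasDerivAt
      (fun v => -((1 - Real.exp (-v)) / v) + Real.exp (-v) * Real.log v)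
      ((1 - Real.exp (-v)) / v ^ 2 - Real.exp (-v) * Real.log v) v := by
    intro v hv
    have hv0 : 0 < v := ht.trans_le hv
    have he : HasDerivAt (fun v => Real.exp (-v)) (Real.exp (-v) * -1) v :=
      (hasDerivAt_id v).neg.exp
    convert! ((he.const_sub 1).div (hasDerivAt_id v) hv0.ne').neg.add
      (he.mul (Real.hasDerivAt_log hv0.ne')) using 1
    simp only [id]
    field_simp
    ring
  have hexp : Tendsto (fun v : ℝ => Real.exp (-v)) atTop (nhds 0) :=
    Real.tendsto_exp_neg_atTop_nhds_zero
  have hlog : Tendsto (fun v : ℝ => Real.exp (-v) * Real.log v) atTop (nhds 0) := by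
    have h := Real.tendsto_pow_mul_exp_neg_atTop_nhds_zero 1
    refine squeeze_zero' ?_ ?_ h
    · filter_upwards [eventually_ge_atTop 1] with v hv
      exact mul_nonneg (Real.exp_pos _).le (Real.log_nonneg hv)
    · filter_upwards [eventually_gt_atTop 0] with v hv
      rw [pow_one, mul_comm]
      gcongr
      linarith [Real.log_le_sub_one_of_pos hv]
  have hlim := (((hexp.const_sub 1).mul tendsto_inv_atTop_zero).neg.add hlog)
  simp only [← div_eq_mul_inv] at hlim
  rw [integral_Ioi_of_hasDerivAt_of_tendsto' hd hint hlim]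
  simp
  ring

theorem integrableOn_sin_div_sq {t : ℝ} (ht : 0 < t) :
    IntegrableOn (fun v : ℝ => Real.sin v / v ^ 2) (Ioi t) := by
  refine Integrable.mono' (integrableOn_Ioi_rpow_of_lt (a := -2) (by norm_num) ht)
    (Measurable.aestronglyMeasurable (by fun_prop)) ?_
  refine (ae_restrict_mem measurableSet_Ioi).mono fun v hv => ?_
  have hv0 : 0 < v := ht.trans hv
  rw [Real.norm_eq_abs, abs_div, abs_of_pos (pow_pos hv0 2), Real.rpow_neg hv0.le,
    Real.rpow_two, ← one_div]
  gcongr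
  exact Real.abs_sin_le_one v

theorem tendsto_integral_sin_div_sq_add_log :
    Tendsto (fun t : ℝ => (∫ v in Ioi t, Real.sin v / v ^ 2) + Real.log t)
      (nhdsWithin 0 (Ioi 0)) (nhds (1 - Real.eulerMascheroniConstant)) := by
  have hg := tendsto_setIntegral_Ioi_nhdsGT_zero integrableOn_sin_sub_one_add_exp_neg_div_sq
  have hl := tendsto_setIntegral_Ioi_nhdsGT_zero integrableOn_exp_neg_mul_log
  rw [integral_sin_sub_one_add_exp_neg_div_sq] at hg
  rw [integral_exp_neg_mul_log] at hl
  have hq : Tendsto (fun t : ℝ => (1 - Real.exp (-t)) / t) (nhdsWithin 0 (Ioi 0)) (nhds 1) := by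
    have hd : HasDerivAt (fun t : ℝ => 1 - Real.exp (-t)) 1 0 := by
      simpa using ((hasDerivAt_id (0 : ℝ)).neg.exp).const_sub 1
    refine (hd.tendsto_slope_zero_right).congr fun t => ?_
    simp [div_eq_inv_mul]
  have hlog : Tendsto (fun t : ℝ => Real.log t * t) (nhdsWithin 0 (Ioi 0)) (nhds 0) :=
    by simpa only [Real.rpow_one] using tendsto_log_mul_rpow_nhdsGT_zero zero_lt_one
  have h := ((hg.add hq).add (hq.mul hlog)).add hl
  rw [zero_add, mul_zero, add_zero, ← sub_eq_add_neg] at h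
  refine h.congr' ?_
  filter_upwards [self_mem_nhdsWithin] with t (ht : 0 < t)
  have i1 : IntegrableOn (fun v : ℝ => (Real.sin v - 1 + Real.exp (-v)) / v ^ 2) (Ioi t) :=
    integrableOn_sin_sub_one_add_exp_neg_div_sq.mono_set (Ioi_subset_Ioi ht.le)
  have i2 : IntegrableOn (fun v : ℝ => Real.exp (-v) * Real.log v) (Ioi t) :=
    integrableOn_exp_neg_mul_log.mono_set (Ioi_subset_Ioi ht.le)
  have i3 : IntegrableOn
      (fun v : ℝ => (1 - Real.exp (-v)) / v ^ 2 - Real.exp (-v) * Real.log v) (Ioi t) := by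
    refine (((integrableOn_sin_div_sq ht).sub i1).sub i2).congr (ae_of_all _ fun v => ?_)
    simp only [Pi.sub_apply]
    ring
  have hsum : ∫ v in Ioi t, Real.sin v / v ^ 2 =
      (∫ v in Ioi t, (Real.sin v - 1 + Real.exp (-v)) / v ^ 2) +
      (∫ v in Ioi t, ((1 - Real.exp (-v)) / v ^ 2 - Real.exp (-v) * Real.log v)) +
      ∫ v in Ioi t, Real.exp (-v) * Real.log v := by
    rw [← integral_add i1 i3, ← integral_add]
    · congr 1 with v
      ring
    · exact i1.add i3
    · exact i2
  rw [hsum, integral_one_sub_exp_neg_div_sq_sub ht i3]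
  field_simp
  ring

theorem integral_sin_div_Ioo {t : ℝ} (ht : 0 < t) :
    ∫ u in Ioo (0 : ℝ) 1, Real.sin (t / u) = t * ∫ v in Ioi t, Real.sin v / v ^ 2 := by
  have himg : (fun v : ℝ => t / v) '' Ioi t = Ioo 0 1 := by
    ext u
    simp only [mem_image, mem_Ioi, mem_Ioo]
    constructor
    · rintro ⟨v, hv, rfl⟩
      have hv0 : 0 < v := ht.trans hv
      exact ⟨by positivity, (div_lt_one hv0).2 hv⟩
    · rintro ⟨hu0, hu1⟩
      exact ⟨t / u, (lt_div_iff₀ hu0).2 (mul_lt_of_lt_one_right ht hu1), by field_simp⟩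
  have hinj : InjOn (fun v : ℝ => t / v) (Ioi t) := by
    intro v hv w hw h
    have hv0 : v ≠ 0 := (ht.trans hv).ne'
    have hw0 : w ≠ 0 := (ht.trans hw).ne'
    field_simp at h
    exact h.symm
  have hd : ∀ v ∈ Ioi t, HasDerivWithinAt (fun v : ℝ => t / v) (-(t / v ^ 2)) (Ioi t) v := by
    intro v hv
    have hv0 : v ≠ 0 := (ht.trans hv).ne'
    have h := ((hasDerivAt_inv hv0).const_mul t).hasDerivWithinAt (s := Ioi t)
    simpa [div_eq_mul_inv] using! h
  rw [← himg, integral_image_eq_integral_abs_deriv_smul measurableSet_Ioi hd hinj,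
    ← integral_const_mul]
  refine setIntegral_congr_fun measurableSet_Ioi fun v hv => ?_
  have hv0 : 0 < v := ht.trans hv
  rw [abs_neg, abs_of_pos (by positivity), div_div_cancel₀ ht.ne', smul_eq_mul]
  ring

theorem integral_cos_div_mul_div_sq {t m : ℝ} (hm : 0 < m) (hm1 : m ≤ 1) :
    ∫ u in Icc m 1, Real.cos (t / u) * (t / u ^ 2) = Real.sin (t / m) - Real.sin t := by
  have hne : ∀ u ∈ uIcc m 1, u ≠ 0 := fun u hu => by
    rw [uIcc_of_le hm1] at hu
    exact (hm.trans_le hu.1).ne'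
  rw [integral_Icc_eq_integral_Ioc, ← intervalIntegral.integral_of_le hm1,
    intervalIntegral.integral_eq_sub_of_hasDerivAt (f := fun u => -Real.sin (t / u))]
  · simp
    ring
  · intro u hu
    convert! ((hasDerivAt_inv (hne u hu)).const_mul t).sin.neg using 1
    simp only [div_eq_mul_inv]
    ring
  · refine ContinuousOn.intervalIntegrable ?_
    exact (Real.continuous_cos.comp_continuousOn (continuousOn_const.div continuousOn_id hne)).mul
      (continuousOn_const.div (continuousOn_id.pow 2) fun u hu => pow_ne_zero 2 (hne u hu))

theorem continuousOn_cos_div_mul_div_sq {t ε : ℝ} (hε : 0 < ε) :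
    ContinuousOn (fun u : ℝ => Real.cos (t / u) * (t / u ^ 2)) (Icc ε 1) := by
  have hne : ∀ u ∈ Icc ε 1, u ≠ 0 := fun u hu => (hε.trans_le hu.1).ne'
  exact (Real.continuous_cos.comp_continuousOn (continuousOn_const.div continuousOn_id hne)).mul
    (continuousOn_const.div (continuousOn_id.pow 2) fun u hu => pow_ne_zero 2 (hne u hu))

/-- Integration by parts against a finite measure on `(0, 1]`, with the singularity of
`sin (t / s)` at `s = 0` cut off at height `ε`. -/
theorem integral_sin_div_max (ν : Measure ℝ) [IsFiniteMeasure ν]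
    (hν : ∀ᵐ s ∂ν, s ∈ Ioc (0 : ℝ) 1) {t ε : ℝ} (hε : 0 < ε) (hε1 : ε ≤ 1) :
    ∫ s, Real.sin (t / max ε s) ∂ν = ν.real univ * Real.sin t +
      ∫ u in Icc ε 1, ν.real (Iic u) * (Real.cos (t / u) * (t / u ^ 2)) := by
  have hk : IntegrableOn (fun u : ℝ => Real.cos (t / u) * (t / u ^ 2)) (Icc ε 1) :=
    (continuousOn_cos_div_mul_div_sq hε).integrableOn_Icc
  have hF : Integrable (Function.uncurry fun s u : ℝ =>
      (Ici s).indicator (fun u => Real.cos (t / u) * (t / u ^ 2)) u)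
      (ν.prod (volume.restrict (Icc ε 1))) := by
    refine ((Integrable.comp_snd hk ν).indicator
      (measurableSet_le measurable_fst measurable_snd)).congr (ae_of_all _ fun p => ?_)
    by_cases h : p.1 ≤ p.2 <;> simp [Function.uncurry, indicator, h]
  have hpt : ∀ s ∈ Ioc (0 : ℝ) 1, Real.sin (t / max ε s) = Real.sin t +
      ∫ u in Icc ε 1, (Ici s).indicator (fun u => Real.cos (t / u) * (t / u ^ 2)) u := by
    intro s hs
    have hset : Icc ε 1 ∩ Ici s = Icc (max ε s) 1 := by
      ext u
      simp only [mem_inter_iff, mem_Icc, mem_Ici, max_le_iff]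
      tauto
    rw [setIntegral_indicator measurableSet_Ici, hset,
      integral_cos_div_mul_div_sq (lt_max_of_lt_left hε) (max_le hε1 hs.2)]
    ring
  have hF1 : Integrable (fun s => ∫ u in Icc ε 1,
      (Ici s).indicator (fun u => Real.cos (t / u) * (t / u ^ 2)) u) ν := hF.integral_prod_left
  rw [integral_congr_ae (hν.mono hpt), integral_add (integrable_const _) hF1,
    integral_const, smul_eq_mul, integral_integral_swap hF]
  congr 2 with u
  have h : ∀ s, (Ici s).indicator (fun u => Real.cos (t / u) * (t / u ^ 2)) u =
      (Iic u).indicator (fun _ => Real.cos (t / u) * (t / u ^ 2)) s := fun s => by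
    simp [indicator]
  simp only [h]
  rw [integral_indicator_const _ measurableSet_Iic, smul_eq_mul]

theorem tendsto_integral_sin_div_max (ν : Measure ℝ) [IsFiniteMeasure ν]
    (hν : ∀ᵐ s ∂ν, s ∈ Ioc (0 : ℝ) 1) (t : ℝ) :
    Tendsto (fun ε : ℝ => ∫ s, Real.sin (t / max ε s) ∂ν) (nhdsWithin 0 (Ioi 0))
      (nhds (∫ s, Real.sin (t / s) ∂ν)) := by
  refine tendsto_integral_filter_of_dominated_convergence (fun _ => 1) ?_ ?_
    (integrable_const _) ?_
  · exact Eventually.of_forall fun ε => Measurable.aestronglyMeasurable (by fun_prop)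
  · exact Eventually.of_forall fun ε => ae_of_all _ fun s => Real.abs_sin_le_one _
  · refine hν.mono fun s hs => tendsto_const_nhds.congr' ?_
    filter_upwards [nhdsWithin_le_nhds (Iio_mem_nhds hs.1)] with ε hε
    rw [max_eq_right (le_of_lt hε)]

theorem measurable_measureReal_Iic (μ : Measure ℝ) [IsFiniteMeasure μ] :
    Measurable fun u => μ.real (Iic u) :=
  Monotone.measurable fun _ _ h => measureReal_mono (Iic_subset_Iic.2 h)

theorem integral_sin_div_sub_mul_integral (μ : Measure ℝ) [IsProbabilityMeasure μ]
    (hμ : ∀ᵐ s ∂μ, s ∈ Ioc (0 : ℝ) 1) {a : ℝ} (t : ℝ)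
    (hD : IntegrableOn (fun u => (μ.real (Iic u) / u - a) / u) (Ioo 0 1)) :
    (∫ s, Real.sin (t / s) ∂μ) - a * ∫ s in Ioo (0 : ℝ) 1, Real.sin (t / s) =
      (1 - a) * Real.sin t +
        t * ∫ u in Ioo (0 : ℝ) 1, (μ.real (Iic u) / u - a) / u * Real.cos (t / u) := by
  have hvol : ∀ᵐ s ∂(volume.restrict (Ioo (0 : ℝ) 1)), s ∈ Ioc (0 : ℝ) 1 :=
    (ae_restrict_mem measurableSet_Ioo).mono fun s hs => ⟨hs.1, hs.2.le⟩
  have hDc : IntegrableOn (fun u => (μ.real (Iic u) / u - a) / u * Real.cos (t / u))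
      (Ioo 0 1) :=
    Integrable.mul_bdd (c := 1) hD (Measurable.aestronglyMeasurable (by fun_prop))
      (ae_of_all _ fun u => Real.abs_cos_le_one _)
  have hlhs := (tendsto_integral_sin_div_max μ hμ t).sub
    ((tendsto_integral_sin_div_max _ hvol t).const_mul a)
  have hcov := (aecover_Ioo_of_Icc (μ := volume) (A := (0 : ℝ)) (B := 1)
    (l := nhdsWithin 0 (Ioi 0)) (a := fun ε : ℝ => ε) (b := fun _ => 1)
    nhdsWithin_le_nhds tendsto_const_nhds).integral_tendsto_of_countably_generated hDc
  refine tendsto_nhds_unique hlhs (((hcov.const_mul t).const_add _).congr' ?_)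
  filter_upwards [Ioo_mem_nhdsGT (zero_lt_one (α := ℝ))] with ε hε
  have hvolIic : ∀ u ∈ Icc ε 1, (volume.restrict (Ioo (0 : ℝ) 1)).real (Iic u) = u := by
    intro u hu
    have hset : Iic u ∩ Ioc 0 1 = Ioc 0 u := by
      ext x
      simp only [mem_inter_iff, mem_Iic, mem_Ioc]
      constructor
      · tauto
      · intro h
        exact ⟨h.2, h.1, h.2.trans hu.2⟩
    rw [Measure.restrict_congr_set Ioo_ae_eq_Ioc, measureReal_restrict_apply measurableSet_Iic,
      hset, Real.volume_real_Ioc_of_le (hε.1.le.trans hu.1), sub_zero]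
  have hk := (continuousOn_cos_div_mul_div_sq (t := t) hε.1)
  have h1 : IntegrableOn (fun u => μ.real (Iic u) * (Real.cos (t / u) * (t / u ^ 2)))
      (Icc ε 1) := by
    refine Integrable.bdd_mul (c := 1) hk.integrableOn_Icc
      (measurable_measureReal_Iic μ).aestronglyMeasurable (ae_of_all _ fun u => ?_)
    rw [Real.norm_of_nonneg measureReal_nonneg]
    exact measureReal_le_one
  have h2 : IntegrableOn (fun u => u * (Real.cos (t / u) * (t / u ^ 2))) (Icc ε 1) :=
    (continuousOn_id.mul hk).integrableOn_Icc
  have hset : Icc ε 1 ∩ Ioo 0 1 = Ico ε 1 := by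
    ext x
    simp only [mem_inter_iff, mem_Icc, mem_Ioo, mem_Ico]
    constructor
    · tauto
    · intro h
      exact ⟨⟨h.1, h.2.le⟩, hε.1.trans_le h.1, h.2⟩
  rw [integral_sin_div_max μ hμ hε.1 hε.2.le, integral_sin_div_max _ hvol hε.1 hε.2.le,
    Measure.restrict_restrict measurableSet_Icc, hset,
    Measure.restrict_congr_set (Ico_ae_eq_Icc (μ := volume)),
    setIntegral_congr_fun (f := fun u => (volume.restrict (Ioo (0 : ℝ) 1)).real (Iic u) *
      (Real.cos (t / u) * (t / u ^ 2))) measurableSet_Icc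
      fun u hu => congrArg (· * (Real.cos (t / u) * (t / u ^ 2))) (hvolIic u hu),
    probReal_univ, measureReal_restrict_apply_univ, Real.volume_real_Ioo_of_le zero_le_one]
  have h3 : t * ∫ u in Icc ε 1, (μ.real (Iic u) / u - a) / u * Real.cos (t / u) =
      (∫ u in Icc ε 1, μ.real (Iic u) * (Real.cos (t / u) * (t / u ^ 2))) -
        a * ∫ u in Icc ε 1, u * (Real.cos (t / u) * (t / u ^ 2)) := by
    rw [← integral_const_mul, ← integral_const_mul, ← integral_sub h1 (h2.const_mul a)]
    refine setIntegral_congr_fun measurableSet_Icc fun u hu => ?_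
    have hu0 : u ≠ 0 := (hε.1.trans_le hu.1).ne'
    field_simp
  rw [h3]
  ring

theorem abs_integral_mul_cos_div_sub_one_le {D : ℝ → ℝ} {t η e K : ℝ}
    (hη : 0 < η) (hη1 : η ≤ 1) (hD : IntegrableOn D (Ioo 0 1))
    (he : ∫ u in Ioo 0 η, |D u| ≤ e) (hK : ∀ u ∈ Ico η 1, |D u| ≤ K) (hK0 : 0 ≤ K) :
    |∫ u in Ioo (0 : ℝ) 1, D u * (Real.cos (t / u) - 1)| ≤ 2 * e + K * (t ^ 2 / (2 * η ^ 2)) := by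
  have hcos : ∀ x : ℝ, |Real.cos x - 1| ≤ 2 ∧ |Real.cos x - 1| ≤ x ^ 2 / 2 := fun x => by
    have h1 := Real.one_sub_sq_div_two_le_cos (x := x)
    have h2 := Real.cos_le_one x
    have h3 := Real.neg_one_le_cos x
    constructor <;> rw [abs_le] <;> constructor <;> linarith [sq_nonneg x]
  have hG : IntegrableOn (fun u => D u * (Real.cos (t / u) - 1)) (Ioo 0 1) :=
    Integrable.mul_bdd (c := 2) hD (Measurable.aestronglyMeasurable (by fun_prop))
      (ae_of_all _ fun u => (hcos _).1)
  have hs1 : Ioo 0 η ⊆ Ioo (0 : ℝ) 1 := Ioo_subset_Ioo_right hη1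
  have hs2 : Ico η 1 ⊆ Ioo (0 : ℝ) 1 := fun u hu => ⟨hη.trans_le hu.1, hu.2⟩
  have hdisj : Disjoint (Ioo 0 η) (Ico η 1) :=
    disjoint_left.2 fun u hu hu' => (hu.2.trans_le hu'.1).false
  rw [← Ioo_union_Ico_eq_Ioo hη hη1, setIntegral_union hdisj measurableSet_Ico
    (hG.mono_set hs1) (hG.mono_set hs2)]
  refine (abs_add_le _ _).trans (add_le_add ?_ ?_)
  · calc |∫ u in Ioo 0 η, D u * (Real.cos (t / u) - 1)|
        ≤ ∫ u in Ioo 0 η, 2 * |D u| := by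
          rw [← Real.norm_eq_abs]
          refine norm_integral_le_of_norm_le ((hD.mono_set hs1).abs.const_mul 2)
            (ae_of_all _ fun u => ?_)
          rw [norm_mul, mul_comm]
          exact mul_le_mul_of_nonneg_right (hcos _).1 (abs_nonneg _)
      _ ≤ 2 * e := by
          rw [integral_const_mul]
          linarith
  · have h := norm_setIntegral_le_of_norm_le_const (μ := volume) (s := Ico η 1)
      (f := fun u => D u * (Real.cos (t / u) - 1)) (C := K * (t ^ 2 / (2 * η ^ 2)))
      measure_Ico_lt_top fun u hu => by
        rw [norm_mul]
        refine mul_le_mul (hK u hu) ((hcos _).2.trans ?_) (norm_nonneg _) hK0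
        rw [div_pow, div_div, mul_comm (u ^ 2) 2]
        gcongr
        exact hu.1
    refine h.trans (mul_le_of_le_one_right (by positivity) ?_)
    rw [Real.volume_real_Ico_of_le hη1]
    linarith

theorem tendsto_sin_div_self_nhdsGT_zero :
    Tendsto (fun t : ℝ => Real.sin t / t) (nhdsWithin 0 (Ioi 0)) (nhds 1) := by
  have h := (Real.hasDerivAt_sin 0).tendsto_slope_zero_right
  simpa [div_eq_inv_mul] using h

theorem integral_sin_div_add_log_sub_eq (μ : Measure ℝ) [IsProbabilityMeasure μ]
    (hμ : ∀ᵐ s ∂μ, s ∈ Ioc (0 : ℝ) 1) {a t : ℝ} (ht : 0 < t)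
    (hD : IntegrableOn (fun u => (μ.real (Iic u) / u - a) / u) (Ioo 0 1)) :
    1 / t * (∫ s, Real.sin (t / s) ∂μ) + a * Real.log t -
        (1 - a * Real.eulerMascheroniConstant +
          ∫ u in Ioo (0 : ℝ) 1, (μ.real (Iic u) / u - a) / u) =
      (1 - a) * (Real.sin t / t - 1) +
        a * ((∫ v in Ioi t, Real.sin v / v ^ 2) + Real.log t -
          (1 - Real.eulerMascheroniConstant)) +
        ∫ u in Ioo (0 : ℝ) 1, (μ.real (Iic u) / u - a) / u * (Real.cos (t / u) - 1) := by
  have h := integral_sin_div_sub_mul_integral μ hμ t hD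
  have hDc : IntegrableOn (fun u => (μ.real (Iic u) / u - a) / u * Real.cos (t / u))
      (Ioo 0 1) :=
    Integrable.mul_bdd (c := 1) hD (Measurable.aestronglyMeasurable (by fun_prop))
      (ae_of_all _ fun u => Real.abs_cos_le_one _)
  simp only [mul_sub, mul_one]
  rw [integral_sub hDc hD]
  rw [integral_sin_div_Ioo ht, sub_eq_iff_eq_add] at h
  rw [h]
  field_simp
  ring

/-- Proposition: `(1/t)∫₀¹ sin(t/u) dF_n(u) + α_n log|t| → c_{F_n}` as `t → 0`,
for each `n` and uniformly in `n`. -/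
theorem sin_integral_plus_log_tendsto_uniformly
    (μ : ℕ → Measure ℝ) [∀ n, IsProbabilityMeasure (μ n)]
    (hsupp : ∀ n, μ n (Set.Ioc (0 : ℝ) 1) = 1)
    (F : ℕ → ℝ → ℝ)
    (hF : ∀ n t, F n t = (μ n (Set.Iic t)).toReal)
    (α : ℕ → ℝ)
    (hαpos : ∀ n, 0 < α n)
    (hαbdd : ∃ c C : ℝ, 0 < c ∧ ∀ n, c ≤ α n ∧ α n ≤ C)
    -- condition (i)
    (hcondi : ∀ ε > (0 : ℝ), ∃ δ > (0 : ℝ), ∀ t : ℝ, 0 < t → t < δ →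
      ∀ n, |F n t / t - α n| < ε)
    -- condition (ii)
    (hcondii : ∀ ε > (0 : ℝ), ∃ δ > (0 : ℝ), ∀ t : ℝ, 0 < t → t < δ →
      ∀ n, (∫⁻ u in Set.Ioo (0 : ℝ) t,
        ENNReal.ofReal (|F n u / u - α n| / u)) < ENNReal.ofReal ε)
    (b c : ℕ → ℝ)
    (hb : ∀ n, b n = ∫ u in Set.Ioo (0 : ℝ) 1, (F n u / u - α n) / u)
    (hc : ∀ n, c n = 1 - α n * Real.eulerMascheroniConstant + b n) :
    (∀ n, Tendsto
        (fun t : ℝ => (1 / t) * (∫ u, Real.sin (t / u) ∂(μ n)) + α n * Real.log |t|)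
        (nhdsWithin 0 {0}ᶜ) (nhds (c n))) ∧
    (∀ ε > (0 : ℝ), ∃ δ > (0 : ℝ), ∀ t : ℝ, t ≠ 0 → |t| < δ → ∀ n,
      |(1 / t) * (∫ u, Real.sin (t / u) ∂(μ n)) + α n * Real.log |t| - c n| < ε) := by
  obtain ⟨c₀, C, hc₀, hαC⟩ := hαbdd
  have hC : 0 < C := (hαpos 0).trans_le (hαC 0).2
  have hμ : ∀ n, ∀ᵐ s ∂(μ n), s ∈ Ioc (0 : ℝ) 1 := fun n =>
    (prob_compl_eq_zero_iff measurableSet_Ioc).2 (hsupp n)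
  obtain rfl : F = fun n u => (μ n).real (Iic u) := funext₂ hF
  set D : ℕ → ℝ → ℝ := fun n u => ((μ n).real (Iic u) / u - α n) / u with hDdef
  have hDmeas : ∀ n, Measurable (D n) := fun n =>
    (((measurable_measureReal_Iic (μ n)).div measurable_id).sub_const _).div measurable_id
  have hsmall : ∀ ε > (0 : ℝ), ∃ η > (0 : ℝ), η ≤ 1 ∧ ∀ n,
      IntegrableOn (D n) (Ioo 0 η) ∧ ∫ u in Ioo 0 η, |D n u| ≤ ε := by
    intro ε hε
    obtain ⟨δ, hδ, h⟩ := hcondii ε hε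
    refine ⟨min (δ / 2) 1, by positivity, min_le_right _ _, fun n => ?_⟩
    have hn := h (min (δ / 2) 1) (by positivity) ((min_le_left _ _).trans_lt (by linarith)) n
    rw [setLIntegral_congr_fun (g := fun u => ENNReal.ofReal |D n u|) measurableSet_Ioo
      fun u hu => by simp only [hDdef, abs_div _ u, abs_of_pos hu.1]] at hn
    constructor
    · refine ⟨(hDmeas n).aestronglyMeasurable, ?_⟩
      rw [hasFiniteIntegral_iff_norm]
      exact hn.trans ENNReal.ofReal_lt_top
    · rw [integral_eq_lintegral_of_nonneg_ae (ae_of_all _ fun u => abs_nonneg _)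
        (hDmeas n).abs.aestronglyMeasurable]
      exact ENNReal.toReal_le_of_le_ofReal hε.le hn.le
  have hDbdd : ∀ n, ∀ η > (0 : ℝ), ∀ u ∈ Ico η 1, |D n u| ≤ (1 / η + C) / η := by
    intro n η hη u hu
    have hu0 : 0 < u := hη.trans_le hu.1
    simp only [hDdef]
    rw [abs_div, abs_of_pos hu0]
    refine div_le_div₀ (by positivity) ((abs_sub _ _).trans (add_le_add ?_ ?_)) hη hu.1
    · rw [abs_of_nonneg (by positivity)]
      exact div_le_div₀ zero_le_one measureReal_le_one hη hu.1
    · rw [abs_of_pos (hαpos n)]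
      exact (hαC n).2
  have hDint : ∀ n, IntegrableOn (D n) (Ioo 0 1) := by
    intro n
    obtain ⟨η, hη, hη1, h⟩ := hsmall 1 one_pos
    rw [← Ioo_union_Ico_eq_Ioo hη hη1]
    exact (h n).1.union (Measure.integrableOn_of_bounded measure_Ico_lt_top.ne
      (hDmeas n).aestronglyMeasurable
      ((ae_restrict_mem measurableSet_Ico).mono (hDbdd n η hη)))
  have hpos : ∀ ε > (0 : ℝ), ∀ᶠ t in nhdsWithin (0 : ℝ) (Ioi 0), ∀ n,
      |1 / t * (∫ u, Real.sin (t / u) ∂(μ n)) + α n * Real.log t - c n| < ε := by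
    intro ε hε
    obtain ⟨η, hη, hη1, hsm⟩ := hsmall (ε / 8) (by positivity)
    set K : ℝ := (1 / η + C) / η
    have hK : 0 < K := by positivity
    have e1 := Metric.tendsto_nhds.1 tendsto_sin_div_self_nhdsGT_zero (ε / (4 * (1 + C)))
      (by positivity)
    have e2 := Metric.tendsto_nhds.1 tendsto_integral_sin_div_sq_add_log (ε / (4 * C))
      (by positivity)
    have e3 : ∀ᶠ t in nhdsWithin (0 : ℝ) (Ioi 0), K * (t ^ 2 / (2 * η ^ 2)) < ε / 4 := by
      have hcont : Continuous fun t : ℝ => K * (t ^ 2 / (2 * η ^ 2)) := by fun_prop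
      exact (hcont.tendsto' 0 0 (by simp)).mono_left nhdsWithin_le_nhds
        (Iio_mem_nhds (by positivity))
    filter_upwards [e1, e2, e3, self_mem_nhdsWithin] with t h1 h2 h3 (ht : 0 < t) n
    rw [Real.dist_eq] at h1 h2
    rw [hc, hb, integral_sin_div_add_log_sub_eq (μ n) (hμ n) ht (hDint n)]
    have b3 := abs_integral_mul_cos_div_sub_one_le (t := t) hη hη1 (hDint n) (hsm n).2
      (hDbdd n η hη) hK.le
    have b1 : |(1 - α n) * (Real.sin t / t - 1)| ≤ ε / 4 := by
      have hα1 : |1 - α n| ≤ 1 + C := by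
        rw [abs_le]
        constructor <;> linarith [hαpos n, (hαC n).2]
      calc |(1 - α n) * (Real.sin t / t - 1)| ≤ (1 + C) * (ε / (4 * (1 + C))) := by
            rw [abs_mul]
            gcongr
        _ = ε / 4 := by field_simp
    have b2 : |α n * ((∫ v in Ioi t, Real.sin v / v ^ 2) + Real.log t -
        (1 - Real.eulerMascheroniConstant))| ≤ ε / 4 := by
      calc _ ≤ C * (ε / (4 * C)) := by
            rw [abs_mul, abs_of_pos (hαpos n)]
            gcongr
            exact (hαC n).2
        _ = ε / 4 := by field_simp
    refine (abs_add_three _ _ _).trans_lt ?_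
    linarith
  have huni : ∀ ε > (0 : ℝ), ∃ δ > (0 : ℝ), ∀ t : ℝ, t ≠ 0 → |t| < δ → ∀ n,
      |(1 / t) * (∫ u, Real.sin (t / u) ∂(μ n)) + α n * Real.log |t| - c n| < ε := by
    intro ε hε
    obtain ⟨δ, hδ, h⟩ := mem_nhdsGT_iff_exists_Ioo_subset.1 (hpos ε hε)
    refine ⟨δ, hδ, fun t ht htδ n => ?_⟩
    have hn := h ⟨abs_pos.2 ht, htδ⟩ n
    rcases abs_choice t with h' | h'
    · rwa [h'] at hn ⊢
    · rw [h'] at hn ⊢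
      simpa [neg_div, integral_neg, div_neg] using hn
  refine ⟨fun n => Metric.tendsto_nhdsWithin_nhds.2 fun ε hε => ?_, huni⟩
  obtain ⟨δ, hδ, h⟩ := huni ε hε
  refine ⟨δ, hδ, fun {t} ht htδ => ?_⟩
  rw [Real.dist_eq]
  exact h t ht (by simpa using htδ) n
end

section
/- Let {F_n}_{n≥1} be a family of distribution functions on [0,1] with F_n(0) = 0 satisfying conditions (i) and (ii). Then (1/t)∫₀¹ sin(t/u) dF_n(u) ∼ −α_n log|t| as t → 0, uniformly in n; that is, lim_{t→0} sup_n | (1/(−t α_n log|t|)) ∫₀¹ sin(t/u) dF_n(u) − 1 | = 0. -/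
open MeasureTheory ProbabilityTheory Filter Set

/-- Integration by parts against a finite measure, in Fubini form. -/
theorem setIntegral_intervalIntegral_eq_intervalIntegral_mul_measureReal
    {ν : Measure ℝ} [IsFiniteMeasure ν] {h : ℝ → ℝ} {t b : ℝ} (htb : t ≤ b)
    (hc : ContinuousOn h (Icc t b)) :
    ∫ u in Ioc t b, (∫ s in u..b, h s) ∂ν = ∫ s in t..b, h s * ν.real (Ioc t s) := by
  have hint : IntegrableOn h (Ioc t b) volume :=
    (hc.integrableOn_compact isCompact_Icc).mono_set Ioc_subset_Icc_self
  have hmeas : MeasurableSet {p : ℝ × ℝ | p.1 ≤ p.2} := measurableSet_le measurable_fst measurable_snd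
  have hprod : Integrable (Function.uncurry fun u s => (Ici u).indicator h s)
      ((ν.restrict (Ioc t b)).prod (volume.restrict (Ioc t b))) := by
    have := (hint.comp_snd (ν.restrict (Ioc t b))).indicator hmeas
    refine this.congr (Eventually.of_forall fun p => ?_)
    simp [Function.uncurry, indicator]
  calc ∫ u in Ioc t b, (∫ s in u..b, h s) ∂ν
      = ∫ u in Ioc t b, (∫ s in Ioc t b, (Ici u).indicator h s) ∂ν := by
        refine setIntegral_congr_fun measurableSet_Ioc fun u hu => ?_
        have hset : Ioc t b ∩ Ici u = Icc u b := by
          ext x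
          have := hu.1
          simp only [mem_inter_iff, mem_Ioc, mem_Ici, mem_Icc]
          grind
        rw [intervalIntegral.integral_of_le hu.2, setIntegral_indicator measurableSet_Ici,
          hset, integral_Icc_eq_integral_Ioc]
    _ = ∫ s in Ioc t b, (∫ u in Ioc t b, (Ici u).indicator h s ∂ν) := integral_integral_swap hprod
    _ = ∫ s in Ioc t b, h s * ν.real (Ioc t s) := by
        refine setIntegral_congr_fun measurableSet_Ioc fun s hs => ?_
        have : ∀ u, (Ici u).indicator h s = (Iic s).indicator (fun _ => h s) u := fun u => by
          simp [indicator]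
        simp only [this]
        rw [setIntegral_indicator measurableSet_Iic, Ioc_inter_Iic, min_eq_right hs.2,
          setIntegral_const, smul_eq_mul, mul_comm]
    _ = _ := (intervalIntegral.integral_of_le htb).symm

theorem intervalIntegral_cos_div_mul {t u : ℝ} (hu : 0 < u) (hu1 : u ≤ 1) :
    ∫ s in u..1, Real.cos (t / s) * (t / s ^ 2) = Real.sin (t / u) - Real.sin t := by
  have hpos : ∀ s ∈ uIcc u 1, s ≠ 0 := fun s hs => by
    rw [uIcc_of_le hu1] at hs
    exact (hu.trans_le hs.1).ne'
  have hderiv : ∀ s ∈ uIcc u 1,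
      HasDerivAt (fun s => -Real.sin (t / s)) (Real.cos (t / s) * (t / s ^ 2)) s := fun s hs => by
    have h := ((hasDerivAt_inv (hpos s hs)).const_mul t).sin.neg
    refine h.congr_deriv ?_
    rw [div_eq_mul_inv t s]
    ring
  rw [intervalIntegral.integral_eq_sub_of_hasDerivAt hderiv]
  · simp only [div_one]
    ring
  · refine ContinuousOn.intervalIntegrable ?_
    fun_prop (disch := simpa using hpos)

/-- Expansion of `∫ sin (t / u) dμ(u)` as `t → 0⁺`, with explicit error, for a probability measure
on `(0, 1]` whose distribution function is close to `a * s` near `0`. -/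
theorem abs_integral_sin_div_sub_le {μ : Measure ℝ} [IsProbabilityMeasure μ]
    (hsupp : μ (Ioc 0 1) = 1) {t a K η D : ℝ} (ht : 0 < t) (ht1 : t < 1) (hD : 0 ≤ D)
    (hK : ∀ s, 0 < s → μ.real (Iic s) ≤ K * s)
    (ha : ∀ s, 0 < s → s ≤ 1 → |μ.real (Iic s) - a * s| ≤ η * s + D * s ^ 2) :
    |(∫ u, Real.sin (t / u) ∂μ) - a * t * (-Real.log t)| ≤
      t * (η * (-Real.log t) + (3 * K + 1 + D)) := by
  have hK0 : 0 ≤ K := by simpa using measureReal_nonneg.trans (hK 1 one_pos)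
  have hpos : ∀ s ∈ uIcc t 1, s ≠ 0 := fun s hs => by
    rw [uIcc_of_le ht1.le] at hs
    exact (ht.trans_le hs.1).ne'
  have hint : Integrable (fun u => Real.sin (t / u)) μ :=
    Integrable.of_bound (by fun_prop) 1
      (Eventually.of_forall fun u => by simpa using Real.abs_sin_le_one _)
  have hsplit : ∫ u, Real.sin (t / u) ∂μ =
      (∫ u in Ioc 0 t, Real.sin (t / u) ∂μ) + ∫ u in Ioc t 1, Real.sin (t / u) ∂μ := by
    rw [← setIntegral_union (Ioc_disjoint_Ioc_of_le le_rfl) measurableSet_Ioc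
      hint.integrableOn hint.integrableOn, Ioc_union_Ioc_eq_Ioc ht.le ht1.le]
    have hae : ∀ᵐ u ∂μ, u ∈ Ioc (0 : ℝ) 1 := (mem_ae_iff_prob_eq_one measurableSet_Ioc).2 hsupp
    rw [Measure.restrict_eq_self_of_ae_mem hae]
  have hsmall : |∫ u in Ioc 0 t, Real.sin (t / u) ∂μ| ≤ K * t := by
    calc |∫ u in Ioc 0 t, Real.sin (t / u) ∂μ| ≤ 1 * μ.real (Ioc 0 t) :=
          norm_setIntegral_le_of_norm_le_const (f := fun u => Real.sin (t / u))
            (measure_lt_top _ _) fun u _ => Real.abs_sin_le_one _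
      _ ≤ μ.real (Iic t) := by
          rw [one_mul]
          exact measureReal_mono Ioc_subset_Iic_self
      _ ≤ K * t := hK t ht
  have hcont : ContinuousOn (fun s => Real.cos (t / s) * (t / s ^ 2)) (uIcc t 1) := by
    fun_prop (disch := simpa using hpos)
  have hlarge : ∫ u in Ioc t 1, Real.sin (t / u) ∂μ =
      Real.sin t * μ.real (Ioc t 1) +
        ∫ s in t..1, Real.cos (t / s) * (t / s ^ 2) * μ.real (Ioc t s) := by
    rw [← setIntegral_intervalIntegral_eq_intervalIntegral_mul_measureReal ht1.le
      (by simpa [uIcc_of_le ht1.le] using hcont)]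
    have : ∫ u in Ioc t 1, (∫ s in u..1, Real.cos (t / s) * (t / s ^ 2)) ∂μ =
        ∫ u in Ioc t 1, (Real.sin (t / u) - Real.sin t) ∂μ :=
      setIntegral_congr_fun measurableSet_Ioc fun u hu =>
        intervalIntegral_cos_div_mul (ht.trans hu.1) hu.2
    rw [this, integral_sub hint.integrableOn (integrable_const _), setIntegral_const, smul_eq_mul]
    ring
  have hsin : |Real.sin t * μ.real (Ioc t 1)| ≤ t := by
    rw [abs_mul, abs_of_nonneg (measureReal_nonneg (μ := μ) (s := Ioc t 1))]
    calc |Real.sin t| * μ.real (Ioc t 1) ≤ |t| * 1 :=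
          mul_le_mul Real.abs_sin_le_abs measureReal_le_one measureReal_nonneg (abs_nonneg _)
      _ = t := by rw [mul_one, abs_of_pos ht]
  have hF : ∀ s, t ≤ s → μ.real (Ioc t s) = μ.real (Iic s) - μ.real (Iic t) := fun s hs => by
    rw [← Iic_sdiff_Iic, measureReal_sdiff (Iic_subset_Iic.2 hs) measurableSet_Iic]
  have hmain : |(∫ s in t..1, Real.cos (t / s) * (t / s ^ 2) * μ.real (Ioc t s)) -
      a * t * (-Real.log t)| ≤ t * (η * (-Real.log t) + (2 * K + D)) := by
    have hlog : a * t * (-Real.log t) = ∫ s in t..1, a * t * s⁻¹ := by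
      rw [intervalIntegral.integral_const_mul, integral_inv fun h => hpos 0 h rfl, one_div,
        Real.log_inv]
    have hi1 : IntervalIntegrable
        (fun s => Real.cos (t / s) * (t / s ^ 2) * μ.real (Ioc t s)) volume t 1 := by
      have hmono : Monotone fun s => μ.real (Ioc t s) := fun x y hxy =>
        measureReal_mono (Ioc_subset_Ioc_right hxy)
      exact hmono.intervalIntegrable.continuousOn_mul hcont
    have hi2 : IntervalIntegrable (fun s => a * t * s⁻¹) volume t 1 := by
      refine ContinuousOn.intervalIntegrable ?_
      fun_prop (disch := simpa using hpos)
    have hi3 : IntervalIntegrable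
        (fun s => t * (η * s⁻¹ + D + 2 * K * t * (s ^ 2)⁻¹)) volume t 1 := by
      refine ContinuousOn.intervalIntegrable ?_
      fun_prop (disch := simpa using hpos)
    rw [hlog, ← intervalIntegral.integral_sub hi1 hi2]
    have hbound := intervalIntegral.norm_integral_le_of_norm_le (μ := volume) ht1.le
      (f := fun s => Real.cos (t / s) * (t / s ^ 2) * μ.real (Ioc t s) - a * t * s⁻¹)
      (Eventually.of_forall fun s hs => ?_) hi3
    · refine hbound.trans ?_
      have hderiv : ∀ s ∈ uIcc t 1, HasDerivAt
          (fun s => t * (η * Real.log s + D * s - 2 * K * t * s⁻¹))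
          (t * (η * s⁻¹ + D + 2 * K * t * (s ^ 2)⁻¹)) s := fun s hs => by
        have h := (((Real.hasDerivAt_log (hpos s hs)).const_mul η).add
          ((hasDerivAt_id s).const_mul D)).sub ((hasDerivAt_inv (hpos s hs)).const_mul (2 * K * t))
        refine (h.const_mul t).congr_deriv ?_
        ring
      rw [intervalIntegral.integral_eq_sub_of_hasDerivAt hderiv hi3, ← mul_sub]
      refine mul_le_mul_of_nonneg_left ?_ ht.le
      rw [mul_assoc (2 * K) t t⁻¹, mul_inv_cancel₀ ht.ne', Real.log_one]
      have := mul_nonneg hD ht.le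
      have := mul_nonneg hK0 ht.le
      linarith
    · have hs0 : 0 < s := ht.trans hs.1
      have hx0 : 0 ≤ t / s := (div_pos ht hs0).le
      have hx1 : t / s ≤ 1 := (div_le_one hs0).2 hs.1.le
      have hcos : 1 - Real.cos (t / s) ≤ t / s := by
        nlinarith [Real.one_sub_sq_div_two_le_cos (x := t / s)]
      have hcos1 := Real.cos_le_one (t / s)
      have hcos0 : |Real.cos (t / s)| ≤ 1 := Real.abs_cos_le_one _
      have hnum : |Real.cos (t / s) * (μ.real (Iic s) - μ.real (Iic t)) - a * s| ≤
          η * s + D * s ^ 2 + 2 * K * t := by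
        have h1 : |(1 - Real.cos (t / s)) * μ.real (Iic s)| ≤ K * t := by
          rw [abs_of_nonneg (mul_nonneg (by linarith) measureReal_nonneg)]
          calc (1 - Real.cos (t / s)) * μ.real (Iic s) ≤ t / s * (K * s) :=
                mul_le_mul hcos (hK s hs0) measureReal_nonneg hx0
            _ = K * t := by field_simp
        have h2 : |Real.cos (t / s) * μ.real (Iic t)| ≤ K * t := by
          rw [abs_mul, abs_of_nonneg (measureReal_nonneg (μ := μ) (s := Iic t))]
          calc _ ≤ 1 * μ.real (Iic t) := mul_le_mul_of_nonneg_right hcos0 measureReal_nonneg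
            _ ≤ K * t := by simpa using hK t ht
        have h3 := ha s hs0 hs.2
        rw [abs_le] at *
        constructor <;> nlinarith
      rw [hF s hs.1.le, Real.norm_eq_abs]
      have heq : Real.cos (t / s) * (t / s ^ 2) * (μ.real (Iic s) - μ.real (Iic t)) - a * t * s⁻¹ =
          t / s ^ 2 * (Real.cos (t / s) * (μ.real (Iic s) - μ.real (Iic t)) - a * s) := by
        field_simp
      rw [heq, abs_mul, abs_of_pos (by positivity)]
      calc _ ≤ t / s ^ 2 * (η * s + D * s ^ 2 + 2 * K * t) :=
            mul_le_mul_of_nonneg_left hnum (by positivity)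
        _ = _ := by field_simp
  rw [hsplit, hlarge]
  rw [abs_le] at *
  constructor <;> nlinarith

/-- Corollary: `(1/t)∫₀¹ sin(t/u) dF_n(u) ∼ −α_n log|t|` as `t → 0`, uniformly in `n`. -/
theorem sin_integral_asymptotic_uniform
    (μ : ℕ → Measure ℝ) [∀ n, IsProbabilityMeasure (μ n)]
    (hsupp : ∀ n, μ n (Set.Ioc (0 : ℝ) 1) = 1)
    (F : ℕ → ℝ → ℝ)
    (hF : ∀ n t, F n t = (μ n (Set.Iic t)).toReal)
    (α : ℕ → ℝ)
    (hαpos : ∀ n, 0 < α n)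
    (hαbdd : ∃ c C : ℝ, 0 < c ∧ ∀ n, c ≤ α n ∧ α n ≤ C)
    -- condition (i)
    (hcondi : ∀ ε > (0 : ℝ), ∃ δ > (0 : ℝ), ∀ t : ℝ, 0 < t → t < δ →
      ∀ n, |F n t / t - α n| < ε)
    -- condition (ii)
    (hcondii : ∀ ε > (0 : ℝ), ∃ δ > (0 : ℝ), ∀ t : ℝ, 0 < t → t < δ →
      ∀ n, (∫⁻ u in Set.Ioo (0 : ℝ) t,
        ENNReal.ofReal (|F n u / u - α n| / u)) < ENNReal.ofReal ε) :
    ∀ ε > (0 : ℝ), ∃ δ > (0 : ℝ), ∀ t : ℝ, t ≠ 0 → |t| < δ → ∀ n,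
      |(1 / (-t * α n * Real.log |t|)) * (∫ u, Real.sin (t / u) ∂(μ n)) - 1| < ε := by
  obtain ⟨c, C, hc, hα⟩ := hαbdd
  intro ε hε
  have hη : 0 < c * ε / 2 := by positivity
  set η := c * ε / 2 with hη_def
  obtain ⟨d, hd, hFd⟩ := hcondi η hη
  have hC : 0 < C := (hαpos 0).trans_le (hα 0).2
  set K := C + η + 1 / d with hK_def
  set D := (K + C) / d with hD_def
  have hK0 : 0 < K := by positivity
  have hD0 : 0 < D := by positivity
  have hF' : ∀ n s, F n s = (μ n).real (Iic s) := hF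
  have hnear : ∀ n s, 0 < s → s < d → |(μ n).real (Iic s) - α n * s| ≤ η * s := by
    intro n s hs hsd
    have h := (hFd s hs hsd n).le
    rw [hF'] at h
    have heq : (μ n).real (Iic s) - α n * s = ((μ n).real (Iic s) / s - α n) * s := by
      field_simp
    rw [heq, abs_mul, abs_of_pos hs]
    exact mul_le_mul_of_nonneg_right h hs.le
  have hK : ∀ n s, 0 < s → (μ n).real (Iic s) ≤ K * s := by
    intro n s hs
    have hd' : 0 < 1 / d * s := by positivity
    rcases lt_or_ge s d with hsd | hsd
    · have h := (abs_le.1 (hnear n s hs hsd)).2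
      have := mul_le_mul_of_nonneg_right (hα n).2 hs.le
      rw [hK_def]
      linarith
    · have h1 : 1 ≤ 1 / d * s := by
        rw [one_div_mul_eq_div]
        exact (one_le_div hd).2 hsd
      have : 0 < (C + η) * s := by positivity
      have := measureReal_le_one (μ := μ n) (s := Iic s)
      rw [hK_def]
      linarith
  have ha : ∀ n s, 0 < s → s ≤ 1 →
      |(μ n).real (Iic s) - α n * s| ≤ η * s + D * s ^ 2 := by
    intro n s hs _
    rcases lt_or_ge s d with hsd | hsd
    · exact (hnear n s hs hsd).trans (le_add_of_nonneg_right (by positivity))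
    · have h1 : (K + C) * s ≤ D * s ^ 2 := by
        have : 1 ≤ s / d := (one_le_div hd).2 hsd
        calc (K + C) * s = (K + C) * s * 1 := (mul_one _).symm
          _ ≤ (K + C) * s * (s / d) := mul_le_mul_of_nonneg_left this (by positivity)
          _ = D * s ^ 2 := by rw [hD_def]; ring
      have h2 := hK n s hs
      have h3 := measureReal_nonneg (μ := μ n) (s := Iic s)
      have h4 := mul_le_mul_of_nonneg_right (hα n).2 hs.le
      have h5 := mul_pos (hαpos n) hs
      have h6 := mul_pos hη hs
      have h7 := mul_pos hK0 hs
      rw [abs_le]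
      constructor <;> nlinarith
  set M := 3 * K + 1 + D with hM_def
  have hM : 0 < M := by positivity
  have hpos : ∀ t : ℝ, 0 < t → t < Real.exp (-(M / η)) → ∀ n,
      |(1 / (-t * α n * Real.log t)) * (∫ u, Real.sin (t / u) ∂(μ n)) - 1| < ε := by
    intro t ht htd n
    have ht1 : t < 1 := htd.trans (Real.exp_lt_one_iff.2 (neg_lt_zero.2 (by positivity)))
    have hL : M / η < -Real.log t := by
      have := (Real.log_lt_iff_lt_exp ht).2 htd
      linarith
    have hL0 : 0 < -Real.log t := (by positivity : 0 < M / η).trans hL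
    have hML : M < -Real.log t * η := (div_lt_iff₀ hη).1 hL
    have hmain := abs_integral_sin_div_sub_le (hsupp n) ht ht1 hD0.le (hK n) (ha n)
    have hden : 0 < α n * t * (-Real.log t) := mul_pos (mul_pos (hαpos n) ht) hL0
    have heq : (1 / (-t * α n * Real.log t)) * (∫ u, Real.sin (t / u) ∂(μ n)) - 1 =
        ((∫ u, Real.sin (t / u) ∂(μ n)) - α n * t * (-Real.log t)) /
          (α n * t * (-Real.log t)) := by
      rw [sub_div, div_self hden.ne', one_div, mul_comm, ← div_eq_mul_inv]
      congr 2
      ring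
    rw [heq, abs_div, abs_of_pos hden, div_lt_iff₀ hden]
    refine hmain.trans_lt ?_
    calc t * (η * (-Real.log t) + M) < t * (2 * η * (-Real.log t)) :=
          mul_lt_mul_of_pos_left (by linarith) ht
      _ = c * (ε * (t * (-Real.log t))) := by rw [hη_def]; ring
      _ ≤ α n * (ε * (t * (-Real.log t))) :=
          mul_le_mul_of_nonneg_right (hα n).1 (by positivity)
      _ = ε * (α n * t * (-Real.log t)) := by ring
  refine ⟨Real.exp (-(M / η)), Real.exp_pos _, fun t ht htd n => ?_⟩
  rcases lt_or_gt_of_ne ht with h | h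
  · rw [abs_of_neg h] at htd ⊢
    have := hpos (-t) (neg_pos.2 h) htd n
    simp only [neg_div, Real.sin_neg, integral_neg] at this
    convert this using 3
    rw [show - -t * α n * Real.log (-t) = -(-t * α n * Real.log (-t)) by ring, one_div, one_div,
      inv_neg, neg_mul_neg]
  · rw [abs_of_pos h] at htd ⊢
    exact hpos t h htd n
end
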